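/- The efficient influence function of the generalized frontdoor formula for a multi-valued treatment has mean zero: for each a° ∈ 𝒜 with a° ≠ a†, define b₀^{a°}(m,l) = E(Y | A=a°, M=m, L=l), h†^{a°}(l) = ∑_m b₀^{a°}(m,l)·P(M=m | A=a†, L=l), ψ₃^{a°} = E(h†^{a°}(L) | A=a°), and Ψ = P(A=a†)·E(Y | A=a†) + ∑_{a°≠a†} P(A=a°)·ψ₃^{a°}. Then E[ 1{A=a†}·Y + ∑_{a°≠a†} 1{A=a°}·ψ₃^{a°} + ∑_{a°≠a†} ( 1{A=a°}·(P(M | A=a†, L)/P(M | A=a°, L))·(Y − b₀^{a°}(M,L)) + 1{A=a†}·(P(A=a° | L)/P(A=a† | L))·(b₀^{a°}(M,L) − h†^{a°}(L)) + 1{A=a°}·(h†^{a°}(L) − ψ₃^{a°}) ) − Ψ ] = 0, where P(M | A=a, L) denotes the random variable ω ↦ P(M=M(ω) | A=a, L=L(ω)) and P(A=a | L) denotes ω ↦ P(A=a | L=L(ω)). -/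

import Mathlib

open scoped Classical
open Finset

/-- Probability of an event `S` under pmf `p` on a finite sample space. -/
noncomputable def Pr {Ω : Type*} [Fintype Ω] (p : Ω → ℝ) (S : Ω → Prop) : ℝ :=
  ∑ ω, if S ω then p ω else 0

/-- Expectation of `X` under pmf `p`. -/
noncomputable def Ex {Ω : Type*} [Fintype Ω] (p : Ω → ℝ) (X : Ω → ℝ) : ℝ :=
  ∑ ω, p ω * X ω

/-- Conditional probability `P(E | S)`. -/
noncomputable def CPr {Ω : Type*} [Fintype Ω] (p : Ω → ℝ) (E S : Ω → Prop) : ℝ :=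
  Pr p (fun ω => E ω ∧ S ω) / Pr p S

/-- Conditional expectation `E(X | S) = E(X · 1_S) / P(S)`. -/
noncomputable def CEx {Ω : Type*} [Fintype Ω] (p : Ω → ℝ) (X : Ω → ℝ) (S : Ω → Prop) : ℝ :=
  Ex p (fun ω => X ω * (if S ω then 1 else 0)) / Pr p S

/-- Indicator of a proposition, as a real number. -/
noncomputable def ind (P : Prop) : ℝ := if P then 1 else 0

theorem Pr_mul_CEx {Ω : Type*} [Fintype Ω] (p X : Ω → ℝ) (S : Ω → Prop) (h : 0 < Pr p S) :
    Pr p S * CEx p X S = ∑ ω, if S ω then p ω * X ω else 0 := by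
  unfold CEx
  rw [mul_div_cancel₀ _ h.ne']
  unfold Ex
  refine Finset.sum_congr rfl fun ω _ => ?_
  by_cases h1 : S ω <;> simp [h1]

theorem Pr_mono {Ω : Type*} [Fintype Ω] (p : Ω → ℝ) (hp : ∀ ω, 0 ≤ p ω) (S T : Ω → Prop)
    (h : ∀ ω, S ω → T ω) : Pr p S ≤ Pr p T := by
  unfold Pr
  refine Finset.sum_le_sum fun ω _ => ?_
  by_cases h1 : S ω
  · simp [h1, h ω h1]
  · by_cases h2 : T ω <;> simp [h1, h2, hp ω]

theorem sum_fib {Ω κ : Type*} [Fintype Ω] [Fintype κ] (K : Ω → κ) (f : Ω → ℝ) :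
    ∑ ω, f ω = ∑ k, ∑ ω, if K ω = k then f ω else 0 := by
  rw [Finset.sum_comm]
  refine Finset.sum_congr rfl fun ω _ => ?_
  simp

theorem term1 {Ω 𝓜 𝓛 𝒜 : Type*} [Fintype Ω] [Fintype 𝓜] [Fintype 𝓛]
    (p : Ω → ℝ) (A : Ω → 𝒜) (a : 𝒜) (M : Ω → 𝓜) (L : Ω → 𝓛) (Y : Ω → ℝ)
    (hpos : ∀ m : 𝓜, ∀ l : 𝓛, 0 < Pr p (fun ω => A ω = a ∧ M ω = m ∧ L ω = l))
    (b c : 𝓜 → 𝓛 → ℝ)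
    (hb : ∀ m l, b m l = CEx p Y (fun ω => A ω = a ∧ M ω = m ∧ L ω = l)) :
    ∑ ω, p ω * (ind (A ω = a) * c (M ω) (L ω) * (Y ω - b (M ω) (L ω))) = 0 := by
  rw [sum_fib (fun ω => (M ω, L ω))]
  refine Finset.sum_eq_zero fun k _ => ?_
  obtain ⟨m, l⟩ := k
  have h := Pr_mul_CEx p Y _ (hpos m l)
  rw [← hb] at h
  have : ∑ ω, (if (M ω, L ω) = (m, l) then
      p ω * (ind (A ω = a) * c (M ω) (L ω) * (Y ω - b (M ω) (L ω))) else 0)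
      = c m l * ((∑ ω, if A ω = a ∧ M ω = m ∧ L ω = l then p ω * Y ω else 0)
        - Pr p (fun ω => A ω = a ∧ M ω = m ∧ L ω = l) * b m l) := by
    unfold Pr
    rw [Finset.sum_mul, ← Finset.sum_sub_distrib, Finset.mul_sum]
    refine Finset.sum_congr rfl fun ω _ => ?_
    by_cases h1 : M ω = m <;> by_cases h2 : L ω = l <;> by_cases h3 : A ω = a <;>
      simp [ind, h1, h2, h3]
    ring
  have h' : (∑ ω, if A ω = a ∧ M ω = m ∧ L ω = l then p ω * Y ω else 0)
      = Pr p (fun ω => A ω = a ∧ M ω = m ∧ L ω = l) * b m l := by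
    rw [h]
    refine Finset.sum_congr rfl fun ω _ => ?_
    congr
  rw [h', sub_self, mul_zero] at this
  rw [← this]
  refine Finset.sum_congr rfl fun ω _ => ?_
  congr

theorem term2 {Ω 𝓜 𝓛 𝒜 : Type*} [Fintype Ω] [Fintype 𝓜] [Fintype 𝓛]
    (p : Ω → ℝ) (A : Ω → 𝒜) (a : 𝒜) (M : Ω → 𝓜) (L : Ω → 𝓛)
    (hpos : ∀ l : 𝓛, 0 < Pr p (fun ω => A ω = a ∧ L ω = l))
    (b : 𝓜 → 𝓛 → ℝ) (g h : 𝓛 → ℝ)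
    (hh : ∀ l, h l = ∑ m, b m l * CPr p (fun ω => M ω = m) (fun ω => A ω = a ∧ L ω = l)) :
    ∑ ω, p ω * (ind (A ω = a) * g (L ω) * (b (M ω) (L ω) - h (L ω))) = 0 := by
  rw [sum_fib L]
  refine Finset.sum_eq_zero fun l _ => ?_
  have e1 : Pr p (fun ω => A ω = a ∧ L ω = l) * h l =
      ∑ m, b m l * Pr p (fun ω => M ω = m ∧ (A ω = a ∧ L ω = l)) := by
    rw [hh, Finset.mul_sum]
    refine Finset.sum_congr rfl fun m _ => ?_
    unfold CPr
    have := (hpos l).ne'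
    field_simp
  have e2 : ∑ m, b m l * Pr p (fun ω => M ω = m ∧ (A ω = a ∧ L ω = l)) =
      ∑ ω, if A ω = a ∧ L ω = l then p ω * b (M ω) l else 0 := by
    rw [sum_fib M]
    refine Finset.sum_congr rfl fun m _ => ?_
    unfold Pr
    rw [Finset.mul_sum]
    refine Finset.sum_congr rfl fun ω _ => ?_
    by_cases h1 : M ω = m <;> by_cases h2 : L ω = l <;> by_cases h3 : A ω = a <;>
      simp [h1, h2, h3]
    ring
  have : ∑ ω, (if L ω = l then
      p ω * (ind (A ω = a) * g (L ω) * (b (M ω) (L ω) - h (L ω))) else 0)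
      = g l * ((∑ ω, if A ω = a ∧ L ω = l then p ω * b (M ω) l else 0)
        - Pr p (fun ω => A ω = a ∧ L ω = l) * h l) := by
    unfold Pr
    rw [Finset.sum_mul, ← Finset.sum_sub_distrib, Finset.mul_sum]
    refine Finset.sum_congr rfl fun ω _ => ?_
    by_cases h2 : L ω = l <;> by_cases h3 : A ω = a <;>
      simp [ind, h2, h3]
    ring
  rw [this, e1, e2]; ring

theorem sum_ind {Ω : Type*} [Fintype Ω] (p X : Ω → ℝ) (S : Ω → Prop) :
    ∑ ω, p ω * (ind (S ω) * X ω) = ∑ ω, if S ω then p ω * X ω else 0 := by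
  refine Finset.sum_congr rfl fun ω _ => ?_
  by_cases h : S ω <;> simp [ind, h]

theorem sum_ind_const {Ω : Type*} [Fintype Ω] (p : Ω → ℝ) (c : ℝ) (S : Ω → Prop) :
    ∑ ω, p ω * (ind (S ω) * c) = Pr p S * c := by
  unfold Pr
  rw [Finset.sum_mul]
  refine Finset.sum_congr rfl fun ω _ => ?_
  by_cases h : S ω <;> simp [ind, h]

/-- The efficient influence function of the generalized frontdoor
formula for a multi-valued treatment has mean zero. -/
theorem generalized_frontdoor_eif_mean_zero_multivalued
    {Ω 𝓜 𝓛 𝒜 : Type*} [Fintype Ω] [Fintype 𝓜] [Fintype 𝓛] [Fintype 𝒜]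
    (p : Ω → ℝ) (hp : ∀ ω, 0 ≤ p ω) (hsum : ∑ ω, p ω = 1)
    (A : Ω → 𝒜) (adag : 𝒜)
    (M : Ω → 𝓜) (L : Ω → 𝓛) (Y : Ω → ℝ)
    (hpos : ∀ a : 𝒜, ∀ m : 𝓜, ∀ l : 𝓛,
      0 < Pr p (fun ω => A ω = a ∧ M ω = m ∧ L ω = l))
    (b0 : 𝒜 → 𝓜 → 𝓛 → ℝ)
    (hb0 : ∀ acirc, acirc ≠ adag → ∀ m l,
      b0 acirc m l = CEx p Y (fun ω => A ω = acirc ∧ M ω = m ∧ L ω = l))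
    (hdag : 𝒜 → 𝓛 → ℝ)
    (hhdag : ∀ acirc, acirc ≠ adag → ∀ l, hdag acirc l = ∑ m : 𝓜,
      b0 acirc m l * CPr p (fun ω => M ω = m) (fun ω => A ω = adag ∧ L ω = l))
    (ψ3 : 𝒜 → ℝ)
    (hψ3 : ∀ acirc, acirc ≠ adag →
      ψ3 acirc = CEx p (fun ω => hdag acirc (L ω)) (fun ω => A ω = acirc))
    (Ψ : ℝ)
    (hΨ : Ψ = Pr p (fun ω => A ω = adag) * CEx p Y (fun ω => A ω = adag) +
      ∑ acirc ∈ Finset.univ.filter (fun a : 𝒜 => a ≠ adag),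
        Pr p (fun ω => A ω = acirc) * ψ3 acirc) :
    Ex p (fun ω =>
      ind (A ω = adag) * Y ω +
      (∑ acirc ∈ Finset.univ.filter (fun a : 𝒜 => a ≠ adag),
        ind (A ω = acirc) * ψ3 acirc) +
      (∑ acirc ∈ Finset.univ.filter (fun a : 𝒜 => a ≠ adag),
        (ind (A ω = acirc) *
           (CPr p (fun ω' => M ω' = M ω) (fun ω' => A ω' = adag ∧ L ω' = L ω) /
            CPr p (fun ω' => M ω' = M ω) (fun ω' => A ω' = acirc ∧ L ω' = L ω)) *
           (Y ω - b0 acirc (M ω) (L ω)) +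
         ind (A ω = adag) *
           (CPr p (fun ω' => A ω' = acirc) (fun ω' => L ω' = L ω) /
            CPr p (fun ω' => A ω' = adag) (fun ω' => L ω' = L ω)) *
           (b0 acirc (M ω) (L ω) - hdag acirc (L ω)) +
         ind (A ω = acirc) * (hdag acirc (L ω) - ψ3 acirc))) - Ψ) = 0 := by
  obtain ⟨ω0⟩ : Nonempty Ω := by
    by_contra hne
    rw [not_nonempty_iff] at hne
    simp at hsum
  have hA : ∀ a, 0 < Pr p (fun ω => A ω = a) := fun a =>
    lt_of_lt_of_le (hpos a (M ω0) (L ω0)) (Pr_mono p hp _ _ fun ω h => h.1)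
  have hAL : ∀ a l, 0 < Pr p (fun ω => A ω = a ∧ L ω = l) := fun a l =>
    lt_of_lt_of_le (hpos a (M ω0) l) (Pr_mono p hp _ _ fun ω h => ⟨h.1, h.2.2⟩)
  unfold Ex
  simp only [mul_sub (p _) _ Ψ, mul_add (p _), Finset.mul_sum, Finset.sum_add_distrib,
    Finset.sum_sub_distrib]
  rw [← Finset.sum_mul, hsum, hΨ, Pr_mul_CEx p Y _ (hA adag), sum_ind p Y (fun ω => A ω = adag)]
  rw [Finset.sum_comm]
  simp only [sum_ind_const p _ (fun ω => A ω = _)]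
  have z1 : ∀ (F : Ω → 𝒜 → ℝ), (∀ a, a ≠ adag → ∑ ω, F ω a = 0) →
      ∑ ω, ∑ a ∈ Finset.univ.filter (fun a : 𝒜 => a ≠ adag), F ω a = 0 := by
    intro F hF
    rw [Finset.sum_comm]
    exact Finset.sum_eq_zero fun a ha => hF a (by simpa using ha)
  rw [z1 (fun ω a => p ω * (ind (A ω = a) * _ * _)), z1 (fun ω a => p ω * (ind (A ω = adag) * _ * _)),
    z1 (fun ω a => p ω * (ind (A ω = a) * (_ - _)))]
  · ring
  · intro a ha
    have h := Pr_mul_CEx p (fun ω => hdag a (L ω)) _ (hA a)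
    rw [← hψ3 a ha, ← sum_ind p _ (fun ω => A ω = a)] at h
    simp only [mul_sub, Finset.sum_sub_distrib]
    rw [← h, sum_ind_const p _ (fun ω => A ω = a), sub_self]
  · intro a ha
    exact term2 p A adag M L (hAL adag) (b0 a)
      (fun l => CPr p (fun ω' => A ω' = a) (fun ω' => L ω' = l) /
            CPr p (fun ω' => A ω' = adag) (fun ω' => L ω' = l)) (hdag a) (hhdag a ha)
  · intro a ha
    exact term1 p A a M L Y (hpos a) (b0 a)
      (fun m l => CPr p (fun ω' => M ω' = m) (fun ω' => A ω' = adag ∧ L ω' = l) /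
            CPr p (fun ω' => M ω' = m) (fun ω' => A ω' = a ∧ L ω' = l)) (hb0 a ha)
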